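/- Let n > 1 and t ≥ 2. The Kirchhoff index of the windmill graph W_{n+1}^t equals Kf(W_{n+1}^t) = (2n²t² − n²t + nt)/(n+1). -/

import Mathlib

open Matrix BigOperators

-- The Laplacian matrix `L = D − A` of a finite simple graph, over `ℝ`.
open Classical in
noncomputable def lapMat {V : Type} [Fintype V] (G : SimpleGraph V) : Matrix V V ℝ :=
  Matrix.of fun i j =>
    if i = j then (Nat.card {v // G.Adj i v} : ℝ)
    else if G.Adj i j then -1 else 0

/-- Vertex set of the windmill graph `W_{n+1}^t`: a central vertex together with
`t` copies of `n` further vertices. -/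
abbrev WindV (n t : ℕ) := Unit ⊕ (Fin t × Fin n)

/-- The windmill graph `W_{n+1}^t`: `t` copies of `K_{n+1}` sharing one common
central vertex. The center is adjacent to every other vertex, and two non-central
vertices are adjacent iff they are distinct and lie in the same copy. -/
def Windmill (n t : ℕ) : SimpleGraph (WindV n t) :=
  SimpleGraph.fromRel (fun u v =>
    u = Sum.inl () ∨ v = Sum.inl () ∨
      ∃ (c : Fin t) (a b : Fin n), u = Sum.inr (c, a) ∧ v = Sum.inr (c, b))

open Classical in
theorem lapMat_mul_apply {V : Type} [Fintype V] (G : SimpleGraph V) (Y : Matrix V V ℝ) (u j : V) :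
    (lapMat G * Y) u j = ∑ v, if G.Adj u v then Y u j - Y v j else 0 := by
  have hcard : (Nat.card {v // G.Adj u v} : ℝ) = ∑ v, if G.Adj u v then 1 else 0 := by
    rw [Nat.card_eq_fintype_card, Fintype.card_subtype, Finset.sum_boole]
  have hentry : ∀ v, lapMat G u v * Y v j =
      (if u = v then (Nat.card {v // G.Adj u v} : ℝ) * Y u j else 0) -
        if G.Adj u v then Y v j else 0 := by
    intro v
    by_cases h : u = v
    · subst h
      simp [lapMat]
    · by_cases h' : G.Adj u v <;> simp [lapMat, h, h']
  rw [Matrix.mul_apply, Finset.sum_congr rfl fun v _ => hentry v, Finset.sum_sub_distrib,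
    Finset.sum_ite_eq, if_pos (Finset.mem_univ u), hcard, Finset.sum_mul,
    ← Finset.sum_sub_distrib]
  refine Finset.sum_congr rfl fun v _ => ?_
  split_ifs <;> simp

theorem lapMat_transpose {V : Type} [Fintype V] (G : SimpleGraph V) :
    (lapMat G)ᵀ = lapMat G := by
  ext i j
  by_cases h : i = j
  · subst h
    rfl
  · have h' : G.Adj j i = G.Adj i j := propext (G.adj_comm j i)
    by_cases hij : G.Adj i j <;> simp [lapMat, h, Ne.symm h, h', hij]

/-- If `Y` is a grounded inverse of the Laplacian (`L Y = I - e_c 1ᵀ`, and row `c` of `Y` vanishes),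
then every `{1}`-inverse of the Laplacian has the same resistance distances as `Y`. -/
theorem resistance_eq_of_grounded_inverse {V : Type} [Fintype V] [DecidableEq V]
    (G : SimpleGraph V) (c : V) (Y X : Matrix V V ℝ)
    (hY : lapMat G * Y = 1 - Matrix.of fun i _ => if i = c then 1 else 0)
    (hc : ∀ j, Y c j = 0) (hX : lapMat G * X * lapMat G = lapMat G) (i j : V) :
    X i i + X j j - X i j - X j i = Y i i + Y j j - Y i j - Y j i := by
  set E : Matrix V V ℝ := Matrix.of fun i _ => if i = c then 1 else 0 with hE
  have hYt : Yᵀ * lapMat G = 1 - Eᵀ := by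
    rw [← lapMat_transpose G, ← Matrix.transpose_mul, hY, Matrix.transpose_sub,
      Matrix.transpose_one]
  have key : (1 - Eᵀ) * X * (1 - E) = Yᵀ * (1 - E) := by
    calc (1 - Eᵀ) * X * (1 - E) = Yᵀ * (lapMat G * X * lapMat G) * Y := by
          rw [← hYt, ← hY]
          simp only [Matrix.mul_assoc]
      _ = Yᵀ * (1 - E) := by rw [hX, Matrix.mul_assoc, hY]
  have entry : ∀ a b, X a b - X c b - (X a c - X c c) = Y b a := by
    intro a b
    have h := congrFun (congrFun key a) b
    simpa [Matrix.mul_apply, Matrix.one_apply, sub_mul, mul_sub, Finset.sum_sub_distrib, hE, hc]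
      using h
  linarith [entry i i, entry j j, entry i j, entry j i]

theorem sum_sum_resistance {V : Type} [Fintype V] (Y : Matrix V V ℝ) :
    ∑ i, ∑ j, (Y i i + Y j j - Y i j - Y j i)
      = 2 * ((Fintype.card V : ℝ) * ∑ i, Y i i - ∑ i, ∑ j, Y i j) := by
  have h : ∑ i, ∑ j, Y j i = ∑ i, ∑ j, Y i j := Finset.sum_comm
  simp only [Finset.sum_sub_distrib, Finset.sum_add_distrib, Finset.sum_const, Finset.card_univ,
    nsmul_eq_mul, h, ← Finset.mul_sum]
  ring

theorem windmill_adj_inl_inr (n t : ℕ) (x : Unit) (p : Fin t × Fin n) :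
    (Windmill n t).Adj (Sum.inl x) (Sum.inr p) := by
  simp [Windmill]

theorem windmill_adj_inr_inr (n t : ℕ) (p q : Fin t × Fin n) :
    (Windmill n t).Adj (Sum.inr p) (Sum.inr q) ↔ p ≠ q ∧ p.1 = q.1 := by
  obtain ⟨i, a⟩ := p
  obtain ⟨j, b⟩ := q
  simp [Windmill]
  grind

/-- The inverse of the windmill Laplacian grounded at the center. -/
noncomputable def windmillGreen (n t : ℕ) : Matrix (WindV n t) (WindV n t) ℝ
  | Sum.inr (i, a), Sum.inr (j, b) =>
      if i = j then (1 + if a = b then 1 else 0) / ((n : ℝ) + 1) else 0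
  | _, _ => 0

theorem lapMat_windmill_mul_green (n t : ℕ) :
    lapMat (Windmill n t) * windmillGreen n t
      = 1 - Matrix.of fun i _ => if i = Sum.inl () then 1 else 0 := by
  classical
  have hn : (n : ℝ) + 1 ≠ 0 := by positivity
  ext u v
  rw [lapMat_mul_apply, Fintype.sum_sum_type]
  rcases u with ⟨⟩ | ⟨i, a⟩ <;> rcases v with ⟨⟩ | ⟨j, b⟩
  · simp [windmillGreen]
  · simp [windmillGreen, windmill_adj_inl_inr, Fintype.sum_prod_type, Finset.sum_ite_irrel,
      ← Finset.sum_div, Finset.sum_add_distrib, div_self hn]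
  · simp [windmillGreen]
  · have hsum : ∀ p : Fin t × Fin n,
        (if (Windmill n t).Adj (Sum.inr (i, a)) (Sum.inr p) then
          windmillGreen n t (Sum.inr (i, a)) (Sum.inr (j, b)) -
            windmillGreen n t (Sum.inr p) (Sum.inr (j, b)) else 0)
        = if i = p.1 then (if i = j then ((if a = b then 1 else 0) -
            if p.2 = b then 1 else 0) / ((n : ℝ) + 1) else 0) else 0 := by
      rintro ⟨k, d⟩
      by_cases hk : i = k
      · subst hk
        by_cases hd : a = d
        · subst hd
          simp
        · by_cases hj : i = j
          · simp [windmill_adj_inr_inr, hd, windmillGreen, hj]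
            ring
          · simp [windmill_adj_inr_inr, hd, windmillGreen, hj]
      · simp [windmill_adj_inr_inr, hk]
    rw [Finset.sum_congr rfl fun p _ => hsum p]
    by_cases hj : i = j
    · subst hj
      by_cases hab : a = b
      · subst hab
        simp [windmillGreen, (windmill_adj_inl_inr n t _ _).symm, Fintype.sum_prod_type,
          Finset.sum_ite_irrel, ← Finset.sum_div]
        field_simp
        ring
      · simp [windmillGreen, (windmill_adj_inl_inr n t _ _).symm, Fintype.sum_prod_type,
          Finset.sum_ite_irrel, ← Finset.sum_div, hab]
        ring
    · simp [windmillGreen, (windmill_adj_inl_inr n t _ _).symm, hj]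

theorem sum_diag_windmillGreen (n t : ℕ) :
    ∑ i, windmillGreen n t i i = (n : ℝ) * t * 2 / (n + 1) := by
  simp [windmillGreen]
  ring

theorem sum_sum_windmillGreen (n t : ℕ) :
    ∑ i, ∑ j, windmillGreen n t i j = (n : ℝ) * t := by
  have hn : (n : ℝ) + 1 ≠ 0 := by positivity
  simp [windmillGreen, Fintype.sum_prod_type, Finset.sum_ite_irrel, ← Finset.sum_div,
    Finset.sum_add_distrib, div_self hn]
  ring

/-- The Kirchhoff index (half the sum over ordered pairs of resistance distances)
of the windmill graph `W_{n+1}^t` (`n > 1`, `t ≥ 2`) equals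
`(2n²t² − n²t + nt)/(n+1)`. -/
theorem kirchhoff_windmill (n t : ℕ) (hn : 1 < n) (ht : 2 ≤ t)
    (X : Matrix (WindV n t) (WindV n t) ℝ)
    (hX : lapMat (Windmill n t) * X * lapMat (Windmill n t) = lapMat (Windmill n t)) :
    (1 / 2) * ∑ i : WindV n t, ∑ j : WindV n t, (X i i + X j j - X i j - X j i)
      = (2 * (n : ℝ)^2 * (t : ℝ)^2 - (n : ℝ)^2 * (t : ℝ) + (n : ℝ) * (t : ℝ))
          / ((n : ℝ) + 1) := by
  classical
  have hn' : (n : ℝ) + 1 ≠ 0 := by positivity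
  simp only [resistance_eq_of_grounded_inverse (Windmill n t) (Sum.inl ()) (windmillGreen n t) X
    (lapMat_windmill_mul_green n t) (fun _ => rfl) hX]
  rw [sum_sum_resistance, sum_diag_windmillGreen, sum_sum_windmillGreen]
  simp only [Fintype.card_sum, Fintype.card_unit, Fintype.card_prod, Fintype.card_fin]
  push_cast
  field_simp
  ring
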